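/- arXiv:1907.12028 — 4 statements merged into one kernel-verified Lean document; each statement's English description precedes it below -/
import Mathlib

section
/- Let n ≥ 1 and 1 ≤ k ≤ n, and throw 2k balls independently and uniformly at random into n bins. Then the probability that at most k bins are nonempty is at most C(n, k) · (k/n)^{2k}, where C(n, k) is the binomial coefficient. -/
open MeasureTheory

/-- The uniform probability measure on `Fin n` bins (for `n ≥ 1`): each bin has mass `1/n`. -/
noncomputable def uniformBins (n : ℕ) : Measure (Fin n) :=
  ((n : ENNReal))⁻¹ • Measure.count

/-- Throwing `m` balls independently and uniformly at random into `n` bins: the product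
probability measure on functions `f : Fin m → Fin n` in which each coordinate is uniform
on `Fin n`; ball `i` lands in bin `f i`. -/
noncomputable def ballsInBins (m n : ℕ) : Measure (Fin m → Fin n) :=
  Measure.pi fun _ => uniformBins n

/-- Throwing `2k` balls uniformly at random into `n` bins (`1 ≤ k ≤ n`), the probability
that at most `k` bins are nonempty is at most `C(n,k)·(k/n)^{2k}`. -/
theorem balls_in_bins_few_filled (n k : ℕ) (hn : 1 ≤ n) (hk : 1 ≤ k) (hkn : k ≤ n) :
    ballsInBins (2 * k) n {f | (Set.range f).ncard ≤ k} ≤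
      (n.choose k : ENNReal) * ((k : ENNReal) / (n : ENNReal)) ^ (2 * k) := by
  have hn0 : (n : ENNReal) ≠ 0 := by
    simp only [ne_eq, Nat.cast_eq_zero]
    omega
  haveI : IsFiniteMeasure (uniformBins n) := by
    refine ⟨?_⟩
    simp only [uniformBins, Measure.smul_apply, smul_eq_mul, Measure.count_univ]
    exact ENNReal.mul_lt_top (ENNReal.inv_lt_top.2 (pos_iff_ne_zero.2 hn0)) (by simp)
  have hsub : {f : Fin (2 * k) → Fin n | (Set.range f).ncard ≤ k} ⊆
      ⋃ S ∈ Finset.powersetCard k (Finset.univ : Finset (Fin n)),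
        Set.pi Set.univ (fun _ : Fin (2 * k) => (S : Set (Fin n))) := by
    intro f hf
    have hf' : (Finset.univ.image f).card ≤ k := by
      have h : (Set.range f).ncard ≤ k := hf
      rwa [← Set.ncard_coe_finset, Finset.coe_image, Finset.coe_univ, Set.image_univ]
    obtain ⟨S, hS, -, hc⟩ := Finset.exists_subsuperset_card_eq
      (Finset.subset_univ (Finset.univ.image f)) hf' (by simpa using hkn)
    simp only [Set.mem_iUnion]
    refine ⟨S, by simp [Finset.mem_powersetCard, hc], ?_⟩
    intro i _
    exact hS (Finset.mem_image_of_mem f (Finset.mem_univ i))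
  refine (measure_mono hsub).trans ((measure_biUnion_finset_le _ _).trans ?_)
  have hS : ∀ S ∈ Finset.powersetCard k (Finset.univ : Finset (Fin n)),
      ballsInBins (2 * k) n (Set.pi Set.univ (fun _ : Fin (2 * k) => (S : Set (Fin n))))
        = ((k : ENNReal) / (n : ENNReal)) ^ (2 * k) := by
    intro S hS
    rw [ballsInBins, Measure.pi_pi]
    simp only [uniformBins, Measure.smul_apply, smul_eq_mul, Measure.count_apply_finset,
      (Finset.mem_powersetCard.1 hS).2, Finset.prod_const, Finset.card_univ, Fintype.card_fin]
    rw [mul_comm, div_eq_mul_inv]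
  rw [Finset.sum_congr rfl hS]
  simp
end

section
/- Let n ≥ 1 and 1 ≤ k ≤ n, and throw 2k balls independently and uniformly at random into n bins. Then the probability that at most k bins are nonempty is at most (e·k/n)^k, where e is Euler's number. -/
open MeasureTheory

theorem uniformBins_apply_aux (n : ℕ) (S : Finset (Fin n)) :
    uniformBins n (S : Set (Fin n)) = (n : ENNReal)⁻¹ * (S.card : ENNReal) := by
  simp [uniformBins]

theorem choose_bound_aux (n k : ℕ) (hn : 1 ≤ n) (hk : 1 ≤ k) :
    (n.choose k : ℝ) * ((n : ℝ)⁻¹ * k) ^ (2 * k) ≤ (Real.exp 1 * (k : ℝ) / (n : ℝ)) ^ k := by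
  have hn' : (0 : ℝ) < n := by exact_mod_cast hn
  have h1 : (n.choose k : ℝ) ≤ (n : ℝ) ^ k / k.factorial := Nat.choose_le_pow_div k n
  have h2 : (k : ℝ) ^ k / k.factorial ≤ Real.exp k :=
    Real.pow_div_factorial_le_exp k (by positivity) k
  have h3 : Real.exp (k : ℝ) = Real.exp 1 ^ k := by rw [← Real.exp_nat_mul]; simp
  calc (n.choose k : ℝ) * ((n : ℝ)⁻¹ * k) ^ (2 * k)
      ≤ ((n : ℝ) ^ k / k.factorial) * ((n : ℝ)⁻¹ * k) ^ (2 * k) := by gcongr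
    _ = ((k : ℝ) ^ k / k.factorial) * ((k : ℝ) / n) ^ k := by
        rw [two_mul, pow_add, mul_pow, div_pow, inv_pow]
        field_simp
    _ ≤ Real.exp k * ((k : ℝ) / n) ^ k := by gcongr
    _ = _ := by rw [h3, ← mul_pow, mul_div_assoc]

/-- Throwing `2k` balls uniformly at random into `n` bins (`1 ≤ k ≤ n`), the probability
that at most `k` bins are nonempty is at most `(e·k/n)^k`, where `e` is Euler's number. -/
theorem balls_in_bins_few_filled_exp (n k : ℕ) (hn : 1 ≤ n) (hk : 1 ≤ k) (hkn : k ≤ n) :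
    ballsInBins (2 * k) n {f | (Set.range f).ncard ≤ k} ≤
      ENNReal.ofReal ((Real.exp 1 * (k : ℝ) / (n : ℝ)) ^ k) := by
  classical
  have hn' : (0 : ℝ) < n := by exact_mod_cast hn
  haveI : IsFiniteMeasure (uniformBins n) := by
    constructor
    rw [← Finset.coe_univ, uniformBins_apply_aux]
    refine ENNReal.mul_lt_top ?_ (by simp)
    simp; omega
  have hsub : {f : Fin (2 * k) → Fin n | (Set.range f).ncard ≤ k} ⊆
      ⋃ S ∈ Finset.powersetCard k (Finset.univ : Finset (Fin n)),
        Set.pi Set.univ (fun _ : Fin (2 * k) => (S : Set (Fin n))) := by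
    intro f hf
    have hc : (Finset.univ.image f).card ≤ k := by
      have h := hf
      rw [Set.mem_setOf_eq] at h
      rwa [← Set.ncard_coe_finset, Finset.coe_image, Finset.coe_univ, Set.image_univ]
    obtain ⟨S, hS, hSc⟩ := Finset.exists_superset_card_eq hc (by simpa using hkn)
    simp only [Set.mem_iUnion]
    refine ⟨S, by simp [Finset.mem_powersetCard, hSc], ?_⟩
    intro i _
    exact hS (Finset.mem_image_of_mem f (Finset.mem_univ i))
  have hterm : ∀ S ∈ Finset.powersetCard k (Finset.univ : Finset (Fin n)),
      ballsInBins (2 * k) n (Set.pi Set.univ (fun _ : Fin (2 * k) => (S : Set (Fin n))))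
        = ENNReal.ofReal (((n : ℝ)⁻¹ * k) ^ (2 * k)) := by
    intro S hS
    rw [ballsInBins, Measure.pi_pi]
    simp only [uniformBins_apply_aux, (Finset.mem_powersetCard.1 hS).2, Finset.prod_const,
      Finset.card_univ, Fintype.card_fin]
    rw [ENNReal.ofReal_pow (by positivity), ENNReal.ofReal_mul (by positivity),
      ENNReal.ofReal_inv_of_pos hn', ENNReal.ofReal_natCast, ENNReal.ofReal_natCast]
  refine (measure_mono hsub).trans ((measure_biUnion_finset_le _ _).trans ?_)
  rw [Finset.sum_congr rfl hterm, Finset.sum_const, Finset.card_powersetCard,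
    Finset.card_univ, Fintype.card_fin, nsmul_eq_mul, ← ENNReal.ofReal_natCast (n.choose k),
    ← ENNReal.ofReal_mul (by positivity)]
  exact ENNReal.ofReal_le_ofReal (choose_bound_aux n k hn hk)
end

section
/- For all natural numbers n ≥ 2 and τ ≥ 0 with τ + 1 ≤ n/2, one has the real inequality (n − τ)·(1 − (1 − 1/n)^{τ+1}) ≥ 3(τ+1)/8. -/
theorem pow_aux (x : ℝ) (h0 : 0 ≤ x) (h1 : x ≤ 1) (t : ℕ) :
    (1 - x) ^ (t + 1) ≤ 1 - (t + 1) * x + (t + 1) * t / 2 * x ^ 2 := by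
  induction t with
  | zero => simp
  | succ k ih =>
    have h2 := mul_le_mul_of_nonneg_right ih (sub_nonneg.mpr h1)
    have h3 : (0 : ℝ) ≤ (k + 1) * k / 2 * x ^ 3 := by positivity
    rw [pow_succ]
    push_cast
    nlinarith

/-- For naturals `n ≥ 2` and `τ ≥ 0` with `τ + 1 ≤ n/2`, the real inequality
`(n − τ)·(1 − (1 − 1/n)^{τ+1}) ≥ 3(τ+1)/8` holds. -/
theorem expected_filled_lower_bound (n τ : ℕ) (hn : 2 ≤ n)
    (h : (τ : ℝ) + 1 ≤ (n : ℝ) / 2) :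
    ((n : ℝ) - (τ : ℝ)) * (1 - (1 - 1 / (n : ℝ)) ^ (τ + 1)) ≥ 3 * ((τ : ℝ) + 1) / 8 := by
  have hn' : (2 : ℝ) ≤ n := by exact_mod_cast hn
  have hx0 : (0 : ℝ) ≤ 1 / n := by positivity
  have hnx : (n : ℝ) * (1 / n) = 1 := by field_simp
  have hx1 : 1 / (n : ℝ) ≤ 1 := by nlinarith
  have hp := pow_aux _ hx0 hx1 τ
  generalize (1 - 1 / (n : ℝ)) ^ (τ + 1) = P at *
  generalize 1 / (n : ℝ) = x at *
  have ht : (0 : ℝ) ≤ τ := by positivity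
  have htx : (τ : ℝ) * x ≤ 1 / 2 := by nlinarith
  have hk : 0 ≤ ((τ : ℝ) + 1) * x := by positivity
  have hP : 3 / 4 * (((τ : ℝ) + 1) * x) ≤ 1 - P := by
    nlinarith [mul_le_mul_of_nonneg_left htx hk]
  have h5 : (n : ℝ) / 2 * (3 / 4 * (((τ : ℝ) + 1) * x)) = 3 * ((τ : ℝ) + 1) / 8 := by
    linear_combination (3 / 8 * ((τ : ℝ) + 1)) * hnx
  rw [ge_iff_le, ← h5]
  apply mul_le_mul _ hP (by positivity) <;> linarith
end

section
/- Let n ≥ 2 and τ ≥ 0 be natural numbers with τ + 1 ≤ n/2, throw τ+1 balls independently and uniformly at random into n bins, fix a set S of n − τ designated bins, and let X be the number of designated bins that are nonempty. Then the probability that X ≤ (τ+1)/4 is at most exp(−(τ+1)/128). -/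
open MeasureTheory

/-- Number of nonempty designated bins. -/
def filledCount {n k : ℕ} (S : Finset (Fin n)) (f : Fin k → Fin n) : ℕ :=
  (S.filter fun j => ∃ i, f i = j).card

lemma filledCount_cons {n k : ℕ} (S : Finset (Fin n)) (f : Fin k → Fin n) (b : Fin n) :
    filledCount S (Fin.cons b f : Fin (k + 1) → Fin n) =
      filledCount S f + if b ∈ S \ (S.filter fun j => ∃ i, f i = j) then 1 else 0 := by
  unfold filledCount
  have e : (S.filter fun j => ∃ i, (Fin.cons b f : Fin (k + 1) → Fin n) i = j) =
      if b ∈ S \ (S.filter fun j => ∃ i, f i = j) then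
        insert b (S.filter fun j => ∃ i, f i = j) else (S.filter fun j => ∃ i, f i = j) := by
    ext j
    simp only [Fin.exists_fin_succ, Fin.cons_zero, Fin.cons_succ, Finset.mem_filter]
    split_ifs with hb
    · simp only [Finset.mem_sdiff, Finset.mem_filter, Finset.mem_insert] at hb ⊢
      constructor
      · rintro ⟨h1, h2 | h2⟩
        · exact Or.inl h2.symm
        · exact Or.inr ⟨h1, h2⟩
      · rintro (rfl | ⟨h1, h2⟩)
        · exact ⟨hb.1, Or.inl rfl⟩
        · exact ⟨h1, Or.inr h2⟩
    · simp only [Finset.mem_sdiff, Finset.mem_filter] at hb ⊢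
      constructor
      · rintro ⟨h1, rfl | h2⟩
        · exact ⟨h1, by tauto⟩
        · exact ⟨h1, h2⟩
      · rintro ⟨h1, h2⟩
        exact ⟨h1, Or.inr h2⟩
  rw [e]
  split_ifs with hb
  · rw [Finset.card_insert_of_notMem (Finset.mem_sdiff.1 hb).2]
  · simp

/-- Truncated exponential weight. -/
noncomputable def wt (m x : ℕ) : ℝ := if 4 * x ≤ m then (5 / 6 : ℝ) ^ (4 * x) else 0

lemma wt_step {n k m : ℕ} (S : Finset (Fin n)) (hm : 2 * m ≤ n) (hS : n < S.card + m)
    (f : Fin k → Fin n) :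
    ∑ b, wt m (filledCount S (Fin.cons b f : Fin (k + 1) → Fin n)) ≤
      wt m (filledCount S f) * (n * (5 / 6 * (127 / 128))) := by
  simp only [filledCount_cons]
  set T := S.filter fun j => ∃ i, f i = j with hT
  have hc : filledCount S f = T.card := rfl
  rw [hc]
  by_cases h4 : 4 * T.card ≤ m
  · have hb : ∀ b : Fin n, wt m (T.card + if b ∈ S \ T then 1 else 0) ≤
        (5 / 6 : ℝ) ^ (4 * T.card) * (1 - if b ∈ S \ T then (1 - (5 / 6 : ℝ) ^ 4) else 0) := by
      intro b
      split_ifs with hb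
      · unfold wt
        split_ifs
        · rw [mul_add, pow_add]; norm_num
        · rw [sub_sub_cancel]; positivity
      · simp [wt, h4]
    refine (Finset.sum_le_sum fun b _ => hb b).trans ?_
    rw [← Finset.mul_sum, wt, if_pos h4]
    refine mul_le_mul_of_nonneg_left ?_ (by positivity)
    rw [Finset.sum_sub_distrib, Finset.sum_ite_mem]
    simp only [Finset.sum_const, Finset.univ_inter, Finset.card_univ, Fintype.card_fin,
      nsmul_eq_mul, mul_one]
    have h1 : (S \ T).card + T.card = S.card :=
      Finset.card_sdiff_add_card_eq_card (Finset.filter_subset _ _)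
    have h2 : 3 * n ≤ 8 * (S \ T).card := by omega
    have h3 : (3 * n : ℝ) ≤ 8 * ((S \ T).card : ℝ) := by exact_mod_cast h2
    have h5 : (0 : ℝ) ≤ n := by positivity
    norm_num
    linarith
  · have : ∀ b : Fin n, wt m (T.card + if b ∈ S \ T then 1 else 0) = 0 := by
      intro b
      unfold wt
      rw [if_neg]
      omega
    rw [Finset.sum_eq_zero fun b _ => this b]
    simp [wt, h4]

lemma wt_sum {n m : ℕ} (S : Finset (Fin n)) (hm : 2 * m ≤ n) (hS : n < S.card + m) (k : ℕ) :
    ∑ f : Fin k → Fin n, wt m (filledCount S f) ≤ (n * (5 / 6 * (127 / 128)) : ℝ) ^ k := by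
  induction k with
  | zero => simp [filledCount, wt]
  | succ k ih =>
    rw [← (Fin.consEquiv fun _ => Fin n).sum_comp, Fintype.sum_prod_type_right]
    calc _ ≤ ∑ f : Fin k → Fin n, wt m (filledCount S f) * (n * (5 / 6 * (127 / 128)) : ℝ) :=
          Finset.sum_le_sum fun f _ => wt_step S hm hS f
      _ ≤ _ := by
          rw [← Finset.sum_mul, pow_succ]
          exact mul_le_mul_of_nonneg_right ih (by positivity)

lemma balls_apply (m n : ℕ) (hn : 0 < n) (A : Finset (Fin m → Fin n)) :
    ballsInBins m n A = ENNReal.ofReal (A.card * ((n : ℝ)⁻¹) ^ m) := by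
  haveI : IsFiniteMeasure (uniformBins n) := by
    refine ⟨?_⟩
    have : (n : ENNReal)⁻¹ ≠ ⊤ := by simp; omega
    simp only [uniformBins, Measure.smul_apply, smul_eq_mul]
    exact ENNReal.mul_lt_top this.lt_top (measure_lt_top _ _)
  rw [← sum_measure_singleton]
  have : ∀ f : Fin m → Fin n, ballsInBins m n {f} = ENNReal.ofReal (((n : ℝ)⁻¹) ^ m) := by
    intro f
    rw [ballsInBins, Measure.pi_singleton]
    simp only [uniformBins, Measure.smul_apply, Measure.count_singleton, smul_eq_mul, mul_one,
      Finset.prod_const, Finset.card_univ, Fintype.card_fin]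
    rw [ENNReal.ofReal_pow (by positivity), ENNReal.ofReal_inv_of_pos (by positivity),
      ENNReal.ofReal_natCast]
  simp only [this, Finset.sum_const, nsmul_eq_mul]
  rw [ENNReal.ofReal_mul (by positivity), ENNReal.ofReal_natCast]

/-- Throwing `τ+1` balls uniformly at random into `n` bins (`n ≥ 2`, `τ + 1 ≤ n/2`), with
a set `S` of `n − τ` designated bins, the probability that at most `(τ+1)/4` designated
bins are nonempty is at most `exp(−(τ+1)/128)`. -/
theorem filled_designated_bins_concentration (n τ : ℕ) (hn : 2 ≤ n)
    (h : (τ : ℝ) + 1 ≤ (n : ℝ) / 2)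
    (S : Finset (Fin n)) (hS : S.card = n - τ) :
    ballsInBins (τ + 1) n
        {f | ((S.filter fun j => ∃ i, f i = j).card : ℝ) ≤ ((τ : ℝ) + 1) / 4} ≤
      ENNReal.ofReal (Real.exp (-(((τ : ℝ) + 1) / 128))) := by
  have hm : 2 * (τ + 1) ≤ n := by
    have : (2 * (τ + 1) : ℝ) ≤ n := by linarith
    exact_mod_cast this
  have key := wt_sum (m := τ + 1) S hm (by omega) (τ + 1)
  set A : Finset (Fin (τ + 1) → Fin n) :=
    Finset.univ.filter fun f => 4 * filledCount S f ≤ τ + 1 with hA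
  have hset : {f : Fin (τ + 1) → Fin n |
      ((S.filter fun j => ∃ i, f i = j).card : ℝ) ≤ ((τ : ℝ) + 1) / 4} = (A : Set _) := by
    ext f
    simp only [hA, Set.mem_ofPred_eq, Finset.coe_filter, Finset.mem_univ, true_and]
    rw [le_div_iff₀ (by norm_num), ← Nat.cast_le (α := ℝ)]
    unfold filledCount
    push_cast
    rw [mul_comm]
  rw [hset, balls_apply _ _ (by omega)]
  apply ENNReal.ofReal_le_ofReal
  have h1 : (A.card : ℝ) * (5 / 6) ^ (τ + 1) ≤ (n * (5 / 6 * (127 / 128)) : ℝ) ^ (τ + 1) := by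
    refine le_trans ?_ key
    rw [← nsmul_eq_mul, ← Finset.sum_const]
    simp only [wt]
    rw [← Finset.sum_filter]
    refine Finset.sum_le_sum fun f hf => ?_
    exact pow_le_pow_of_le_one (by norm_num) (by norm_num) (Finset.mem_filter.1 hf).2
  have hn0 : (0 : ℝ) < n := by positivity
  have h2 : (A.card : ℝ) ≤ (n : ℝ) ^ (τ + 1) * (127 / 128) ^ (τ + 1) := by
    rw [mul_pow, mul_pow] at h1
    have : (0 : ℝ) < (5 / 6) ^ (τ + 1) := by positivity
    refine le_of_mul_le_mul_right (h1.trans_eq ?_) this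
    ring
  calc (A.card : ℝ) * ((n : ℝ)⁻¹) ^ (τ + 1)
      ≤ (n : ℝ) ^ (τ + 1) * (127 / 128) ^ (τ + 1) * ((n : ℝ)⁻¹) ^ (τ + 1) := by gcongr
    _ = (127 / 128) ^ (τ + 1) := by
        rw [mul_right_comm, ← mul_pow, mul_inv_cancel₀ hn0.ne', one_pow, one_mul]
    _ ≤ (Real.exp (-(1 / 128))) ^ (τ + 1) := by
        gcongr
        have := Real.add_one_le_exp (-(1 / 128 : ℝ))
        linarith
    _ = _ := by
        rw [← Real.exp_nat_mul]
        congr 1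
        push_cast
        ring
end
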